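/- arXiv:2007.10832 — 2 statements merged into one kernel-verified Lean document; each statement's English description precedes it below -/
import Mathlib

section
/- Let n,h ∈ ℕ with h dividing n and let H be an ordered graph on h vertices. If G is an ordered graph on n vertices with minimum degree δ(G) ≥ (1 − 1/h)n, then G contains a perfect H-tiling. -/
open Finset

section Defs

variable {h n : ℕ}

/-- `φ` is an order-preserving embedding of the ordered graph `H` into the ordered graph `G`:
a strictly increasing map carrying edges of `H` to edges of `G`. -/
def IsOrderedCopy (H : SimpleGraph (Fin h)) (G : SimpleGraph (Fin n))
    (φ : Fin h → Fin n) : Prop :=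
  StrictMono φ ∧ ∀ i j : Fin h, H.Adj i j → G.Adj (φ i) (φ j)

/-- `S` is the vertex set of a copy of the ordered graph `H` in the ordered graph `G`. -/
def IsCopySet (H : SimpleGraph (Fin h)) (G : SimpleGraph (Fin n))
    (S : Finset (Fin n)) : Prop :=
  ∃ φ : Fin h → Fin n, IsOrderedCopy H G φ ∧ Finset.image φ Finset.univ = S

/-- `G` has an `H`-tiling (vertex-disjoint copies of `H`) whose copies exactly cover the
vertex set `S`; equivalently, the induced ordered subgraph `G[S]` has a perfect `H`-tiling. -/
def HasPerfectTilingOn (H : SimpleGraph (Fin h)) (G : SimpleGraph (Fin n))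
    (S : Finset (Fin n)) : Prop :=
  ∃ 𝒯 : Finset (Finset (Fin n)),
    (∀ T ∈ 𝒯, IsCopySet H G T) ∧
    (𝒯 : Set (Finset (Fin n))).PairwiseDisjoint id ∧
    𝒯.biUnion id = S

/-- `G` has a perfect `H`-tiling. -/
def HasPerfectTiling (H : SimpleGraph (Fin h)) (G : SimpleGraph (Fin n)) : Prop :=
  HasPerfectTilingOn H G Finset.univ

/-- The degree of a vertex in an ordered graph. -/
noncomputable def odeg (G : SimpleGraph (Fin n)) (v : Fin n) : ℕ :=
  (G.neighborSet v).ncard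

/-- `[h]` can be partitioned into `k` intervals, each independent in `H`
(expressed via a monotone colouring with independent fibres). -/
def HasIntervalColoring (H : SimpleGraph (Fin h)) (k : ℕ) : Prop :=
  ∃ c : Fin h → Fin k, Monotone c ∧ ∀ i j : Fin h, H.Adj i j → c i ≠ c j

/-- The interval chromatic number `χ<(H)` of an ordered graph. -/
noncomputable def intervalChi (H : SimpleGraph (Fin h)) : ℕ :=
  sInf {k | HasIntervalColoring H k}

/-- `α⁺ᵢ(H)`: `α⁺₀ = 0`, and `α⁺_{i+1}` is the largest `k ≤ h` such that the interval
`[α⁺ᵢ + 1, k]` is independent in `H` (vertices are 1-indexed via `v ↦ (v : ℕ) + 1`). -/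
noncomputable def alphaPlus (H : SimpleGraph (Fin h)) : ℕ → ℕ
  | 0 => 0
  | (i + 1) => sSup {k | k ≤ h ∧ ∀ a b : Fin h,
      alphaPlus H i + 1 ≤ (a : ℕ) + 1 → (a : ℕ) + 1 ≤ k →
      alphaPlus H i + 1 ≤ (b : ℕ) + 1 → (b : ℕ) + 1 ≤ k → ¬ H.Adj a b}

/-- `α⁻ᵢ(H)`: `α⁻₀ = h + 1`, and `α⁻_{i+1}` is the smallest `k ≥ 1` such that the interval
`[k, α⁻ᵢ − 1]` is independent in `H`. -/
noncomputable def alphaMinus (H : SimpleGraph (Fin h)) : ℕ → ℕ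
  | 0 => h + 1
  | (i + 1) => sInf {k | 1 ≤ k ∧ ∀ a b : Fin h,
      k ≤ (a : ℕ) + 1 → (a : ℕ) + 1 ≤ alphaMinus H i - 1 →
      k ≤ (b : ℕ) + 1 → (b : ℕ) + 1 ≤ alphaMinus H i - 1 → ¬ H.Adj a b}

/-- `α*(H) = min over 1 ≤ ℓ < χ<(H) of min{α⁺_ℓ/(ℓh), (h − α⁻_ℓ + 1)/(ℓh)}`. -/
noncomputable def alphaStar (H : SimpleGraph (Fin h)) : ℝ :=
  sInf {x : ℝ | ∃ ℓ : ℕ, 1 ≤ ℓ ∧ ℓ < intervalChi H ∧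
    (x = (alphaPlus H ℓ : ℝ) / (ℓ * h) ∨
     x = ((h : ℝ) - alphaMinus H ℓ + 1) / (ℓ * h))}

/-- `α*(H)` for ordered graphs with interval chromatic number 2:
`min{α⁺₁(H)/h, (h − α⁻₁(H) + 1)/h}`. -/
noncomputable def alphaStar2 (H : SimpleGraph (Fin h)) : ℝ :=
  min ((alphaPlus H 1 : ℝ) / h) (((h : ℝ) - alphaMinus H 1 + 1) / h)

/-- Property A: no edges of `H` within `[1, ⌊h/2⌋ + 1]` nor within `[⌈h/2⌉, h]`. -/
def PropertyA (H : SimpleGraph (Fin h)) : Prop :=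
  (∀ a b : Fin h, (a : ℕ) + 1 ≤ h / 2 + 1 → (b : ℕ) + 1 ≤ h / 2 + 1 → ¬ H.Adj a b) ∧
  (∀ a b : Fin h, (h + 1) / 2 ≤ (a : ℕ) + 1 → (h + 1) / 2 ≤ (b : ℕ) + 1 → ¬ H.Adj a b)

/-- Property B: for each partition of `[h]` into nonempty intervals `[1, i], [i+1, h]`
there is an edge of `H` between them. -/
def PropertyB (H : SimpleGraph (Fin h)) : Prop :=
  ∀ i : ℕ, 1 ≤ i → i < h →
    ∃ a b : Fin h, H.Adj a b ∧ (a : ℕ) + 1 ≤ i ∧ i + 1 ≤ (b : ℕ) + 1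

/-- `s(H)`: the smallest vertex adjacent to `h`, and `0` if `h` is isolated. -/
noncomputable def sOG (H : SimpleGraph (Fin h)) : ℕ :=
  sInf {k | ∃ a b : Fin h, H.Adj a b ∧ (a : ℕ) + 1 = k ∧ (b : ℕ) + 1 = h}

open Classical in
/-- `l(H)`: the largest vertex adjacent to `1`, and `h + 1` if `1` is isolated. -/
noncomputable def lOG (H : SimpleGraph (Fin h)) : ℕ :=
  if ∃ a b : Fin h, H.Adj a b ∧ (a : ℕ) + 1 = 1 then
    sSup {k | ∃ a b : Fin h, H.Adj a b ∧ (a : ℕ) + 1 = 1 ∧ (b : ℕ) + 1 = k}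
  else h + 1

/-- The vertex `h` has Property C: `s(H) ≥ 1` and there is an edge within `[s(H), h − 1]`. -/
def PropertyCLast (H : SimpleGraph (Fin h)) : Prop :=
  1 ≤ sOG H ∧ ∃ a b : Fin h, H.Adj a b ∧
    sOG H ≤ (a : ℕ) + 1 ∧ (a : ℕ) + 1 ≤ h - 1 ∧
    sOG H ≤ (b : ℕ) + 1 ∧ (b : ℕ) + 1 ≤ h - 1

/-- The vertex `1` has Property C: `l(H) ≤ h` and there is an edge within `[2, l(H)]`. -/
def PropertyCFirst (H : SimpleGraph (Fin h)) : Prop :=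
  lOG H ≤ h ∧ ∃ a b : Fin h, H.Adj a b ∧
    2 ≤ (a : ℕ) + 1 ∧ (a : ℕ) + 1 ≤ lOG H ∧
    2 ≤ (b : ℕ) + 1 ∧ (b : ℕ) + 1 ≤ lOG H

/-- `S` is an `H`-absorbing set for `W`: both `G[S]` and `G[S ∪ W]` have perfect `H`-tilings. -/
def IsAbsorbingFor (H : SimpleGraph (Fin h)) (G : SimpleGraph (Fin n))
    (S W : Finset (Fin n)) : Prop :=
  HasPerfectTilingOn H G S ∧ HasPerfectTilingOn H G (S ∪ W)

end Defs

section Regularity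

/-- The density `d(A,B) = e(A,B)/(|A||B|)` of a pair of vertex sets in a graph. -/
noncomputable def pairDensity {V : Type*} (G : SimpleGraph V) (A B : Finset V) : ℝ :=
  ({e : V × V | e.1 ∈ A ∧ e.2 ∈ B ∧ G.Adj e.1 e.2}.ncard : ℝ) /
    ((A.card : ℝ) * (B.card : ℝ))

/-- The pair `(A, B)` is `ε`-regular in `G`. -/
def IsRegularPair {V : Type*} (G : SimpleGraph V) (A B : Finset V) (ε : ℝ) : Prop :=
  ∀ X ⊆ A, ∀ Y ⊆ B, ε * A.card ≤ (X.card : ℝ) → ε * B.card ≤ (Y.card : ℝ) →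
    |pairDensity G A B - pairDensity G X Y| < ε

end Regularity

section Bottle

/-- The chromatic number of a finite graph. -/
noncomputable def chromNum {m : ℕ} (B : SimpleGraph (Fin m)) : ℕ :=
  sInf {k | ∃ c : Fin m → Fin k, ∀ x y : Fin m, B.Adj x y → c x ≠ c y}

/-- `σ(B)`: the smallest size of a colour class in any proper colouring of `B`
with `χ(B)` colours. -/
noncomputable def sigmaMinCl {m : ℕ} (B : SimpleGraph (Fin m)) : ℕ :=
  sInf {c | ∃ C : Fin m → Fin (chromNum B),
    (∀ x y : Fin m, B.Adj x y → C x ≠ C y) ∧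
    ∃ i : Fin (chromNum B), c = (Finset.univ.filter (fun v => C v = i)).card}

/-- The critical chromatic number `χ_cr(B) = (χ(B) − 1)·|B|/(|B| − σ(B))`. -/
noncomputable def critChrom {m : ℕ} (B : SimpleGraph (Fin m)) : ℝ :=
  ((chromNum B : ℝ) - 1) * m / ((m : ℝ) - sigmaMinCl B)

/-- `φ` is an interval labeling of the complete multipartite graph with part function `p`
(with respect to some permutation `σ` of the parts). -/
def IsIntervalLabeling {m k : ℕ} (p : Fin m → Fin k) (φ : Equiv.Perm (Fin m)) : Prop :=
  ∃ σ : Equiv.Perm (Fin k), ∀ x y : Fin m, σ (p x) < σ (p y) → φ x < φ y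

/-- `G` is (an isomorphic realisation of) the ordered blow-up `(B(t), φ)` of the complete
multipartite graph `B` with part function `p`: there is a block assignment `β` whose fibres
all have size `t`, compatible with the order induced by `φ`, with adjacency between blocks
given by `B`. -/
def IsOrderedBlowup {m k : ℕ} (p : Fin m → Fin k) (φ : Equiv.Perm (Fin m)) (t : ℕ)
    {N : ℕ} (G : SimpleGraph (Fin N)) : Prop :=
  ∃ β : Fin N → Fin m,
    (∀ x : Fin m, {u : Fin N | β u = x}.ncard = t) ∧
    (∀ u v : Fin N, u ≤ v → φ (β u) ≤ φ (β v)) ∧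
    (∀ u v : Fin N, G.Adj u v ↔ p (β u) ≠ p (β v))

/-- The complete multipartite graph with part function `p` is a bottlegraph assigned to `H`:
for every interval labeling `φ` there is a `t ≥ 1` such that the ordered blow-up `(B(t), φ)`
has a perfect `H`-tiling. -/
def IsBottlegraph {h m k : ℕ} (H : SimpleGraph (Fin h)) (p : Fin m → Fin k) : Prop :=
  ∀ φ : Equiv.Perm (Fin m), IsIntervalLabeling p φ →
    ∃ t : ℕ, 0 < t ∧ ∀ (N : ℕ) (G : SimpleGraph (Fin N)),
      IsOrderedBlowup p φ t G → HasPerfectTiling H G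

end Bottle

namespace HajnalSzemeredi

section Digraph

variable {ι : Type*} {R : ι → ι → Prop} {a : ι}

/-- `SimpleReach R a X c`: there is a simple directed `R`-path from `c` to `a` avoiding `X`. -/
inductive SimpleReach (R : ι → ι → Prop) (a : ι) : Set ι → ι → Prop
  | refl {X : Set ι} : a ∉ X → SimpleReach R a X a
  | step {X : Set ι} {c d : ι} :
      R c d → c ∉ X → SimpleReach R a (insert c X) d → SimpleReach R a X c

theorem SimpleReach.notMem {X : Set ι} {c : ι} (hc : SimpleReach R a X c) : c ∉ X := by
  cases hc <;> assumption

theorem SimpleReach.target_notMem {X : Set ι} {c : ι} (hc : SimpleReach R a X c) : a ∉ X := by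
  induction hc with
  | refl h => exact h
  | step _ _ _ ih => exact fun h => ih (Set.mem_insert_of_mem _ h)

theorem SimpleReach.anti {X : Set ι} {c : ι} (hc : SimpleReach R a X c) :
    ∀ {Y : Set ι}, Y ⊆ X → SimpleReach R a Y c := by
  induction hc with
  | refl ha => exact fun hY => .refl fun h => ha (hY h)
  | step hR hX _ ih =>
    exact fun hY => .step hR (fun h => hX (hY h)) (ih (Set.insert_subset_insert hY))

theorem SimpleReach.cut {X : Set ι} {c : ι} (hc : SimpleReach R a X c) (x : ι) :
    SimpleReach R a (insert x X) c ∨ SimpleReach R a X x := by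
  induction hc with
  | @refl X ha =>
    by_cases hx : x = a
    · rw [hx]
      exact .inr (.refl ha)
    · exact .inl (.refl (by simp [ha, Ne.symm hx]))
  | @step X c d hR hX hd ih =>
    rcases ih with h | h
    · by_cases hx : x = c
      · exact .inr (hx ▸ .step hR hX hd)
      · refine .inl (.step hR (by simp [hX, Ne.symm hx]) ?_)
        rwa [Set.insert_comm]
    · exact .inr (h.anti (Set.subset_insert _ _))

theorem SimpleReach.head {X : Set ι} {c d : ι} (hR : R c d) (hX : c ∉ X)
    (hd : SimpleReach R a X d) : SimpleReach R a X c := by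
  rcases hd.cut c with h | h
  · exact .step hR hX h
  · exact h

theorem SimpleReach.avoid_unreachable {X : Set ι} {c : ι} (hc : SimpleReach R a X c) :
    ∀ {Y : Set ι}, Y ⊆ X →
      SimpleReach R a (X ∪ {e | ¬ SimpleReach R a Y e}) c := by
  induction hc with
  | @refl X ha =>
    intro Y hY
    refine .refl ?_
    rintro (h | h)
    · exact ha h
    · exact h (.refl fun h' => ha (hY h'))
  | @step X c d hR hX hd ih =>
    intro Y hY
    refine .step hR ?_ ?_
    · rintro (h | h)
      · exact hX h
      · exact h ((SimpleReach.step hR hX hd).anti hY)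
    · rw [← Set.insert_union]
      exact ih (hY.trans (Set.subset_insert _ _))

theorem SimpleReach.mono {R' : ι → ι → Prop} {X Y : Set ι} {c : ι}
    (hc : SimpleReach R a X c) (hYX : Y ⊆ X)
    (hR : ∀ x y, SimpleReach R a Y x → SimpleReach R a Y y → R x y → R' x y) :
    SimpleReach R' a Y c := by
  induction hc with
  | @refl X ha => exact .refl fun h => ha (hYX h)
  | @step X c d hcd hX hd ih =>
    have hY : Y ⊆ insert c X := hYX.trans (Set.subset_insert _ _)
    exact .head (hR c d ((SimpleReach.step hcd hX hd).anti hYX) (hd.anti hY) hcd)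
      (fun h => hX (hYX h)) (ih hY)

open scoped Classical in
/-- If something other than `a` reaches `a`, then there are a vertex `U` and a nonempty set `T`
of vertices reaching `a` whose edges to vertices reaching `a` end in `T` or at `U`, and such that
deleting any vertex of `T` does not disconnect any other vertex from `a`. -/
theorem exists_terminal_set [Fintype ι] (R : ι → ι → Prop) (a : ι)
    (hne : ∃ c, c ≠ a ∧ SimpleReach R a ∅ c) :
    ∃ (U : ι) (T : Finset ι), T.Nonempty ∧ U ∉ T ∧ SimpleReach R a ∅ U ∧
      (∀ W ∈ T, W ≠ a ∧ SimpleReach R a ∅ W ∧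
        ∀ c, c ≠ W → SimpleReach R a ∅ c → SimpleReach R a {W} c) ∧
      (∀ W ∈ T, ∀ d, R W d → SimpleReach R a ∅ d → d ∈ T ∨ d = U) := by
  let T : ι → Finset ι := fun U =>
    univ.filter fun c => c ≠ U ∧ SimpleReach R a ∅ c ∧ ¬ SimpleReach R a {U} c
  let N : Finset ι := univ.filter fun U => SimpleReach R a ∅ U ∧ (T U).Nonempty
  have hN : N.Nonempty := by
    obtain ⟨c, hca, hc⟩ := hne
    refine ⟨a, ?_⟩
    simp only [N, mem_filter, mem_univ, true_and]
    refine ⟨.refl (by simp), c, ?_⟩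
    simp only [T, mem_filter, mem_univ, true_and]
    refine ⟨hca, hc, fun h => ?_⟩
    exact h.target_notMem rfl
  obtain ⟨U, hU, hmin⟩ := exists_min_image N (fun U => (T U).card) hN
  simp only [N, mem_filter, mem_univ, true_and] at hU hmin
  have memT : ∀ {U c}, c ∈ T U ↔ c ≠ U ∧ SimpleReach R a ∅ c ∧ ¬ SimpleReach R a {U} c := by
    simp [T]
  refine ⟨U, T U, hU.2, by simp [T], hU.1, fun W hW => ?_, fun W hW d hd hd' => ?_⟩
  · have hW' := memT.1 hW
    -- vertices reaching `a` without `U` also reach it without `W`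
    have avoid : ∀ {c}, SimpleReach R a {U} c → SimpleReach R a {W} c := fun {c} hc =>
      (hc.avoid_unreachable subset_rfl).anti (by
        rintro x rfl
        exact .inr hW'.2.2)
    have hUW : U = a ∨ SimpleReach R a {W} U := by
      cases hU.1 with
      | refl => exact .inl rfl
      | @step _ _ d h1 h2 h3 =>
        refine .inr (.head h1 (by simpa using hW'.1.symm) (avoid ?_))
        simpa using h3
    have hWa : W ≠ a := by
      rintro rfl
      exact hW'.2.2 (.refl hW'.1)
    have hUW' : SimpleReach R a {W} U := by
      rcases hUW with h | h
      · rw [h]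
        exact .refl (by simpa using hWa.symm)
      · exact h
    refine ⟨hWa, hW'.2.1, ?_⟩
    by_contra! hcon
    obtain ⟨c, hcW, hc, hc'⟩ := hcon
    have hle := hmin W ⟨hW'.2.1, c, memT.2 ⟨hcW, hc, hc'⟩⟩
    have hlt : T W ⊂ T U := by
      refine (Finset.ssubset_iff_of_subset fun e he => ?_).2 ⟨W, hW, by simp [T]⟩
      have he := memT.1 he
      refine memT.2 ⟨?_, he.2.1, fun h => he.2.2 (avoid h)⟩
      rintro rfl
      exact he.2.2 hUW'
    exact absurd (card_lt_card hlt) (not_lt.2 hle)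
  · by_contra! hcon
    have hW' := memT.1 hW
    have : SimpleReach R a {U} d := by
      by_contra h
      exact hcon.1 (memT.2 ⟨hcon.2, hd', h⟩)
    exact hW'.2.2 (.head hd hW'.1 this)

end Digraph

section Coloring

open scoped Classical

variable {V ι : Type*} {G : SimpleGraph V} {f : V → ι}

/-- `f` is a proper colouring of `G`. -/
def IsProper (G : SimpleGraph V) (f : V → ι) : Prop :=
  ∀ u v, G.Adj u v → f u ≠ f v

/-- Some vertex of colour `c` has no neighbour of colour `d`. -/
def Movable (G : SimpleGraph V) (f : V → ι) (c d : ι) : Prop :=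
  ∃ y, f y = c ∧ ∀ w, G.Adj y w → f w ≠ d

/-- `z` is the only neighbour of `y` in the colour class of `z`. -/
def Solo (G : SimpleGraph V) (f : V → ι) (y z : V) : Prop :=
  G.Adj y z ∧ ∀ w, G.Adj y w → f w = f z → w = z

theorem IsProper.update (hf : IsProper G f) {v : V} {c : ι}
    (hv : ∀ w, G.Adj v w → f w ≠ c) : IsProper G (Function.update f v c) := by
  intro x y hxy
  have hne := hxy.ne
  by_cases hx : x = v
  · subst hx
    simpa [Function.update_of_ne hne.symm] using (hv y hxy).symm
  · by_cases hy : y = v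
    · subst hy
      simpa [Function.update_of_ne hx] using hv x hxy.symm
    · simpa [Function.update_of_ne hx, Function.update_of_ne hy] using hf x y hxy

variable [Fintype V]

/-- The colour class of `c`. -/
noncomputable def cls (f : V → ι) (c : ι) : Finset V := univ.filter fun v => f v = c

theorem mem_cls {f : V → ι} {c : ι} {v : V} : v ∈ cls f c ↔ f v = c := by
  simp [cls]

/-- The neighbours of `v` whose colour lies in `P`. -/
noncomputable def nbIn (G : SimpleGraph V) (f : V → ι) (v : V) (P : Finset ι) : Finset V :=
  univ.filter fun w => G.Adj v w ∧ f w ∈ P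

/-- The neighbours of `v`. -/
noncomputable def nbs (G : SimpleGraph V) (v : V) : Finset V :=
  univ.filter fun w => G.Adj v w

theorem card_cls_update (f : V → ι) (v : V) (c e : ι) :
    #(cls (Function.update f v c) e) + (if e = f v then 1 else 0) =
      #(cls f e) + (if e = c then 1 else 0) := by
  unfold cls
  rw [card_filter, card_filter, ← add_sum_erase _ _ (mem_univ v),
    ← add_sum_erase _ (fun x => if f x = e then 1 else 0) (mem_univ v)]
  have : ∑ x ∈ univ.erase v, (if Function.update f v c x = e then 1 else 0) =
      ∑ x ∈ univ.erase v, (if f x = e then 1 else 0) := by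
    refine sum_congr rfl fun x hx => ?_
    rw [Function.update_of_ne (ne_of_mem_erase hx)]
  rw [this, Function.update_self]
  simp only [eq_comm (a := e)]
  omega

/-- Shifting one vertex along every edge of a simple path of movable classes. -/
theorem SimpleReach.exists_shift (hf : IsProper G f) {a : ι} {X : Set ι} {c : ι}
    (hc : SimpleReach (Movable G f) a X c) :
    ∃ g : V → ι, IsProper G g ∧ (∀ e ∈ X, ∀ v, g v = e ↔ f v = e) ∧
      (∀ v, g v = c → f v = c) ∧
      ∀ e, #(cls g e) + (if e = c then 1 else 0) = #(cls f e) + (if e = a then 1 else 0) := by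
  induction hc with
  | refl ha => exact ⟨f, hf, by simp, by simp, by simp⟩
  | @step X c d hcd hX hd ih =>
    obtain ⟨g, hg, hgX, hgd, hsize⟩ := ih
    obtain ⟨y, rfl, hy⟩ := hcd
    have hgy : g y = f y := (hgX (f y) (by simp) y).2 rfl
    have hdX := hd.notMem
    simp only [Set.mem_insert_iff, not_or] at hdX
    refine ⟨Function.update g y d, hg.update fun w hw h => hy w hw (hgd w h), ?_, ?_, ?_⟩
    · intro e he v
      by_cases hv : v = y
      · subst hv
        rw [Function.update_self]
        constructor
        · rintro rfl
          exact absurd he hdX.2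
        · rintro rfl
          exact absurd he hX
      · rw [Function.update_of_ne hv]
        exact hgX e (Set.mem_insert_of_mem _ he) v
    · intro v hv
      by_cases hvy : v = y
      · rw [hvy]
      · rw [Function.update_of_ne hvy] at hv
        exact (hgX (f y) (by simp) v).1 hv
    · intro e
      have h1 := card_cls_update g y d e
      have h2 := hsize e
      rw [hgy] at h1
      omega

/-- Recolour the inaccessible part except `y` by `φ`, give `y` the colour `W` of its only
neighbour `z` in `W`, and give `z` the colour `X`. -/
theorem exists_recolor {g φ : V → ι} (hg : IsProper G g) {A : Finset ι} {y z : V} {X : ι} {s : ℕ}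
    (hy : g y ∉ A) (hz : g z ∈ A) (hX : X ≠ g z) (hyz : Solo G g y z)
    (hφA : ∀ v, g v ∉ A → v ≠ y → φ v ∉ A)
    (hφ : ∀ u v, g u ∉ A → u ≠ y → g v ∉ A → v ≠ y → G.Adj u v → φ u ≠ φ v)
    (hφs : ∀ e, e ∉ A → #(univ.filter fun v => (g v ∉ A ∧ v ≠ y) ∧ φ v = e) = s)
    (hzA : ∀ v, g v ∈ A → G.Adj z v → g v ≠ X)
    (hzB : ∀ v, g v ∉ A → v ≠ y → G.Adj z v → φ v ≠ X) :
    ∃ F : V → ι, IsProper G F ∧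
      (∀ v, g v ∈ A → v ≠ z → F v = g v) ∧ F y = g z ∧ F z = X ∧
      (∀ v, g v ∉ A → v ≠ y → F v ∉ A) ∧
      (∀ e ∈ A, #(cls F e) = #(cls g e) + (if e = X then 1 else 0)) ∧
      (∀ e, e ∉ A → #(cls F e) = s + (if e = X then 1 else 0)) := by
  have hyz' : y ≠ z := by
    rintro rfl
    exact hy hz
  let F₀ : V → ι := fun v => if g v ∉ A ∧ v ≠ y then φ v else g v
  let F : V → ι := Function.update (Function.update F₀ z X) y (g z)
  have Fy : F y = g z := by simp [F]
  have Fz : F z = X := by simp [F, Function.update_of_ne hyz'.symm]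
  have FA : ∀ v, g v ∈ A → v ≠ z → F v = g v := by
    intro v hv hvz
    have hvy : v ≠ y := by
      rintro rfl
      exact hy hv
    simp [F, Function.update_of_ne hvy, Function.update_of_ne hvz, F₀, hv]
  have FB : ∀ v, g v ∉ A → v ≠ y → F v = φ v := by
    intro v hv hvy
    have hvz : v ≠ z := by
      rintro rfl
      exact hv hz
    simp [F, Function.update_of_ne hvz, F₀, hv, hvy]
  have hsize : ∀ e, #(cls F e) + (if e = g y then 1 else 0) =
      #(cls F₀ e) + (if e = X then 1 else 0) := by
    intro e
    have h1 := card_cls_update (Function.update F₀ z X) y (g z) e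
    have h2 := card_cls_update F₀ z X e
    have h3 : Function.update F₀ z X y = g y := by simp [Function.update_of_ne hyz', F₀]
    have h4 : F₀ z = g z := by simp [F₀, hz]
    rw [h3] at h1
    rw [h4] at h2
    change #(cls F e) + _ = _ at h1
    omega
  have half : ∀ u v, G.Adj u v → (u = y ∨ (u = z ∧ v ≠ y) ∨ (u ≠ y ∧ u ≠ z ∧ v ≠ y ∧ v ≠ z)) →
      F u ≠ F v := by
    rintro u v huv (rfl | ⟨rfl, hvy⟩ | ⟨huy, huz, hvy, hvz⟩)
    · rw [Fy]
      by_cases hv : v = z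
      · rw [hv, Fz]
        exact hX.symm
      · by_cases hvA : g v ∈ A
        · rw [FA v hvA hv]
          exact fun h => hv (hyz.2 v huv h.symm)
        · rw [FB v hvA huv.ne.symm]
          intro h
          exact hφA v hvA huv.ne.symm (h ▸ hz)
    · rw [Fz]
      by_cases hvA : g v ∈ A
      · rw [FA v hvA huv.ne.symm]
        exact (hzA v hvA huv).symm
      · rw [FB v hvA hvy]
        exact (hzB v hvA hvy huv).symm
    · by_cases huA : g u ∈ A <;> by_cases hvA : g v ∈ A
      · rw [FA u huA huz, FA v hvA hvz]
        exact hg u v huv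
      · rw [FA u huA huz, FB v hvA hvy]
        exact fun h => hφA v hvA hvy (h ▸ huA)
      · rw [FB u huA huy, FA v hvA hvz]
        exact fun h => hφA u huA huy (h ▸ hvA)
      · rw [FB u huA huy, FB v hvA hvy]
        exact hφ u v huA huy hvA hvy huv
  refine ⟨F, ?_, FA, Fy, Fz, ?_, ?_, ?_⟩
  · intro u v huv
    have h1 := half u v huv
    have h2 := half v u huv.symm
    have h3 := huv.ne
    grind
  · intro v hv hvy
    rw [FB v hv hvy]
    exact hφA v hv hvy
  · intro e he
    have h := hsize e
    have hey : e ≠ g y := by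
      rintro rfl
      exact hy he
    have : cls F₀ e = cls g e := by
      ext v
      simp only [cls, mem_filter, mem_univ, true_and, F₀]
      split_ifs with hv
      · exact ⟨fun h => absurd (h ▸ he) (hφA v hv.1 hv.2), fun h => absurd (h ▸ he) hv.1⟩
      · rfl
    simpa [hey, this] using h
  · intro e he
    have h := hsize e
    have key : #(cls F₀ e) = s + (if e = g y then 1 else 0) := by
      rw [← hφs e he]
      by_cases hey : e = g y
      · have : cls F₀ e = insert y (univ.filter fun v => (g v ∉ A ∧ v ≠ y) ∧ φ v = e) := by
          ext v
          simp only [cls, mem_filter, mem_univ, true_and, F₀, mem_insert]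
          grind
        rw [this, card_insert_of_notMem (by simp), if_pos hey]
      · have : cls F₀ e = univ.filter fun v => (g v ∉ A ∧ v ≠ y) ∧ φ v = e := by
          ext v
          simp only [cls, mem_filter, mem_univ, true_and, F₀]
          grind
        rw [this, if_neg hey, add_zero]
    omega

theorem card_nbIn (v : V) (P : Finset ι) : #(nbIn G f v P) = ∑ e ∈ P, #(nbIn G f v {e}) := by
  rw [card_eq_sum_card_fiberwise (f := f) (t := P) (by simp [nbIn, Set.MapsTo])]
  refine sum_congr rfl fun e he => ?_
  congr 1
  ext w
  simp only [nbIn, mem_filter, mem_univ, true_and, mem_singleton]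
  grind

theorem card_nbIn_add_card_nbIn_le (v : V) {P Q : Finset ι} (hPQ : Disjoint P Q) :
    #(nbIn G f v P) + #(nbIn G f v Q) ≤ #(nbs G v) := by
  rw [← card_union_of_disjoint]
  · refine card_le_card fun w hw => ?_
    simp only [nbIn, nbs, mem_union, mem_filter, mem_univ, true_and] at hw ⊢
    tauto
  · rw [disjoint_left] at hPQ ⊢
    simp only [nbIn, mem_filter, mem_univ, true_and]
    exact fun w h h' => hPQ h.2 h'.2

theorem nbIn_singleton_pos {v : V} {e : ι} (h : ∃ w, G.Adj v w ∧ f w = e) :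
    1 ≤ #(nbIn G f v {e}) := by
  obtain ⟨w, hw⟩ := h
  exact card_pos.2 ⟨w, by simpa [nbIn] using hw⟩

theorem card_add_card_nbIn_le {v : V} {P Q : Finset ι} (hPQ : Disjoint P Q)
    (hP : ∀ e ∈ P, ∃ w, G.Adj v w ∧ f w = e) :
    #P + #(nbIn G f v Q) ≤ #(nbs G v) := by
  refine le_trans (Nat.add_le_add_right ?_ _) (card_nbIn_add_card_nbIn_le v hPQ)
  rw [card_nbIn v P, card_eq_sum_ones]
  exact sum_le_sum fun e he => nbIn_singleton_pos (hP e he)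

theorem card_add_card_add_card_nbIn_le {y : V} {P Q T : Finset ι} (hPQ : Disjoint P Q)
    (hT : T ⊆ P) (hP : ∀ e ∈ P, ∃ w, G.Adj y w ∧ f w = e) :
    #P + #T + #(nbIn G f y Q) ≤
      #(nbs G y) + #(univ.filter fun z => f z ∈ T ∧ Solo G f y z) := by
  have h1 := card_nbIn_add_card_nbIn_le (G := G) (f := f) y hPQ
  have h2 : #(univ.filter fun z => f z ∈ T ∧ Solo G f y z) =
      ∑ e ∈ T, #(univ.filter fun z => f z = e ∧ Solo G f y z) := by
    rw [card_eq_sum_card_fiberwise (f := f) (t := T) (by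
      intro z hz
      simp only [coe_filter, mem_univ, true_and, Set.mem_ofPred_eq] at hz
      exact hz.1)]
    refine sum_congr rfl fun e he => ?_
    congr 1
    ext w
    simp only [mem_filter, mem_univ, true_and]
    grind
  have h3 : ∑ e ∈ T, 2 ≤ ∑ e ∈ T, (#(nbIn G f y {e}) +
      #(univ.filter fun z => f z = e ∧ Solo G f y z)) := by
    refine sum_le_sum fun e he => ?_
    have hpos := nbIn_singleton_pos (hP e (hT he))
    by_cases hone : #(nbIn G f y {e}) = 1
    · obtain ⟨z, hz⟩ := card_eq_one.1 hone
      have hmem : ∀ w, (G.Adj y w ∧ f w = e) ↔ w = z := by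
        intro w
        have := congrArg (w ∈ ·) hz
        simpa [nbIn] using this
      have hz' := (hmem z).2 rfl
      have : 1 ≤ #(univ.filter fun z => f z = e ∧ Solo G f y z) := by
        refine card_pos.2 ⟨z, ?_⟩
        simp only [mem_filter, mem_univ, true_and]
        exact ⟨hz'.2, hz'.1, fun w hw hwz => (hmem w).1 ⟨hw, hwz.trans hz'.2⟩⟩
      omega
    · omega
  have h4 : ∑ e ∈ P \ T, 1 ≤ ∑ e ∈ P \ T, #(nbIn G f y {e}) :=
    sum_le_sum fun e he => nbIn_singleton_pos (hP e (mem_sdiff.1 he).1)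
  have h5 := sum_sdiff (f := fun e => #(nbIn G f y {e})) hT
  have h6 := card_sdiff_add_card_eq_card hT
  have h7 := card_nbIn (G := G) (f := f) y P
  rw [sum_add_distrib, ← h2] at h3
  simp only [sum_const, smul_eq_mul, mul_one] at h3 h4
  omega

/-- Double counting of the edges between a colour class `W` and the vertices coloured in `Q`,
where solo vertices of `W` count twice. -/
theorem two_mul_card_le {W : ι} {Q : Finset ι} {q : ℕ}
    (hQ : ∀ y, f y ∈ Q → ∃ w, G.Adj y w ∧ f w = W)
    (hsolo : ∀ z, f z = W → (∃ y, f y ∈ Q ∧ Solo G f y z) → #(nbIn G f z Q) ≤ q)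
    (hall : ∀ z, f z = W → #(nbIn G f z Q) ≤ 2 * q) :
    2 * #(univ.filter fun y => f y ∈ Q) ≤ 2 * q * #(cls f W) := by
  let wt : V → ℕ := fun z => if ∃ y, f y ∈ Q ∧ Solo G f y z then 2 else 1
  have h1 : ∀ y ∈ univ.filter (fun y => f y ∈ Q),
      2 ≤ ∑ z ∈ cls f W, if G.Adj y z then wt z else 0 := by
    intro y hy
    simp only [mem_filter, mem_univ, true_and] at hy
    rw [← sum_filter]
    obtain ⟨z, hyz, hz⟩ := hQ y hy
    have hzmem : z ∈ (cls f W).filter (G.Adj y) := by simp [cls, hz, hyz]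
    by_cases hs : Solo G f y z
    · have : wt z = 2 := if_pos ⟨y, hy, hs⟩
      rw [← this]
      exact single_le_sum (f := wt) (fun _ _ => Nat.zero_le _) hzmem
    · have hex : ∃ w, G.Adj y w ∧ f w = f z ∧ w ≠ z := by
        by_contra! hcon
        exact hs ⟨hyz, hcon⟩
      obtain ⟨w, hyw, hw, hwz⟩ := hex
      have hsub : ({w, z} : Finset V) ⊆ (cls f W).filter (G.Adj y) := by
        intro x hx
        simp only [mem_insert, mem_singleton] at hx
        rcases hx with rfl | rfl
        · simp [cls, hw, hz, hyw]
        · exact hzmem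
      calc 2 = ∑ _x ∈ ({w, z} : Finset V), 1 := by simp [card_pair hwz]
        _ ≤ ∑ x ∈ ({w, z} : Finset V), wt x := by
          refine sum_le_sum fun x _ => ?_
          simp only [wt]
          split_ifs <;> simp
        _ ≤ _ := sum_le_sum_of_subset hsub
  have h2 : ∀ z ∈ cls f W,
      ∑ y ∈ univ.filter (fun y => f y ∈ Q), (if G.Adj y z then wt z else 0) ≤ 2 * q := by
    intro z hz
    simp only [cls, mem_filter, mem_univ, true_and] at hz
    rw [← sum_filter, sum_const, smul_eq_mul]
    have : (univ.filter (fun y => f y ∈ Q)).filter (fun y => G.Adj y z) = nbIn G f z Q := by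
      ext w
      simp only [nbIn, mem_filter, mem_univ, true_and, G.adj_comm]
      tauto
    rw [this]
    simp only [wt]
    split_ifs with h
    · have := hsolo z hz h
      omega
    · simpa using hall z hz
  calc 2 * #(univ.filter fun y => f y ∈ Q)
      = ∑ _y ∈ univ.filter (fun y => f y ∈ Q), 2 := by simp [mul_comm]
    _ ≤ ∑ y ∈ univ.filter (fun y => f y ∈ Q), ∑ z ∈ cls f W, if G.Adj y z then wt z else 0 :=
        sum_le_sum h1
    _ = ∑ z ∈ cls f W, ∑ y ∈ univ.filter (fun y => f y ∈ Q), if G.Adj y z then wt z else 0 :=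
        sum_comm
    _ ≤ ∑ _z ∈ cls f W, 2 * q := sum_le_sum h2
    _ = 2 * q * #(cls f W) := by simp [mul_comm]

theorem exists_indep_sum_ge (G : SimpleGraph V) (f : V → ι) (Q : Finset ι) :
    ∃ I : Finset V, (∀ y ∈ I, f y ∈ Q) ∧ (∀ y ∈ I, ∀ y' ∈ I, ¬ G.Adj y y') ∧
      #(univ.filter fun y => f y ∈ Q) ≤ ∑ y ∈ I, (#(nbIn G f y Q) + 1) := by
  let N : Finset (Finset V) := univ.filter fun I =>
    (∀ y ∈ I, f y ∈ Q) ∧ (∀ y ∈ I, ∀ y' ∈ I, ¬ G.Adj y y')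
  have hN : N.Nonempty := ⟨∅, by simp [N]⟩
  obtain ⟨I, hI, hmax⟩ := exists_max_image N card hN
  simp only [N, mem_filter, mem_univ, true_and] at hI hmax
  refine ⟨I, hI.1, hI.2, ?_⟩
  have hsub : (univ.filter fun y => f y ∈ Q) ⊆ I.biUnion fun y => insert y (nbIn G f y Q) := by
    intro v hv
    simp only [mem_filter, mem_univ, true_and] at hv
    simp only [mem_biUnion, mem_insert, nbIn, mem_filter, mem_univ, true_and]
    by_contra! hcon
    have hvI : v ∉ I := fun h => (hcon v h).1 rfl
    have := hmax (insert v I) ⟨by simpa [hv] using hI.1, by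
      intro y hy y' hy' hadj
      rcases mem_insert.1 hy with rfl | h1 <;> rcases mem_insert.1 hy' with rfl | h2
      · exact hadj.ne rfl
      · exact (hcon y' h2).2 hadj.symm hv
      · exact (hcon y h1).2 hadj hv
      · exact hI.2 y h1 y' h2 hadj⟩
    rw [card_insert_of_notMem hvI] at this
    omega
  exact (card_le_card hsub).trans (card_biUnion_le.trans
    (sum_le_sum fun y _ => card_insert_le _ _))

variable [Fintype ι]

/-- A nearly equitable colouring (one class too small, one class too large) of a graph whose
degrees are less than the number of colours can be turned into an equitable one, provided
that equitable colourings with fewer colours exist. -/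
theorem exists_equitable_of_nearly_equitable {s : ℕ} (hdeg : ∀ v, #(nbs G v) < Fintype.card ι)
    (hfew : ∀ (C : Finset ι) (S : Finset V), #C < Fintype.card ι → #S = #C * s →
      (∀ v ∈ S, #(S.filter fun w => G.Adj v w) < #C) →
      ∃ φ : V → ι, (∀ v ∈ S, φ v ∈ C) ∧ (∀ u ∈ S, ∀ v ∈ S, G.Adj u v → φ u ≠ φ v) ∧
        ∀ c ∈ C, #(S.filter fun v => φ v = c) = s)
    (N : ℕ) : ∀ (f : V → ι) (a b : ι), IsProper G f →
      (∀ e, #(cls f e) + (if e = a then 1 else 0) = s + (if e = b then 1 else 0)) →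
      #(univ.filter fun e => ¬ SimpleReach (Movable G f) a ∅ e) ≤ N →
      ∃ g : V → ι, IsProper G g ∧ ∀ e, #(cls g e) = s := by
  induction N with
  | zero =>
    intro f a b hf hsize hN
    have hb : SimpleReach (Movable G f) a ∅ b := by
      by_contra h
      have := card_pos.2 ⟨b, (mem_filter.2 ⟨mem_univ _, h⟩ :
        b ∈ univ.filter fun e => ¬ SimpleReach (Movable G f) a ∅ e)⟩
      omega
    obtain ⟨g, hg, -, -, h⟩ := hb.exists_shift hf
    exact ⟨g, hg, fun e => by have := h e; have := hsize e; omega⟩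
  | succ N ih =>
    intro f a b hf hsize hN
    by_cases hb : SimpleReach (Movable G f) a ∅ b
    · obtain ⟨g, hg, -, -, h⟩ := hb.exists_shift hf
      exact ⟨g, hg, fun e => by have := h e; have := hsize e; omega⟩
    have ha : SimpleReach (Movable G f) a ∅ a := .refl (by simp)
    have hab : a ≠ b := fun h => hb (h ▸ ha)
    set A : Finset ι := univ.filter fun e => SimpleReach (Movable G f) a ∅ e with hA
    set Q : Finset ι := univ.filter fun e => ¬ SimpleReach (Movable G f) a ∅ e with hQ
    have memA : ∀ {e}, e ∈ A ↔ SimpleReach (Movable G f) a ∅ e := by simp [hA]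
    have memQ : ∀ {e}, e ∈ Q ↔ e ∉ A := by simp [hA, hQ]
    have hAQ : Disjoint A Q := by
      rw [disjoint_left]
      exact fun e he he' => memQ.1 he' he
    have haA : a ∈ A := memA.2 ha
    have hbQ : b ∈ Q := memQ.2 fun h => hb (memA.1 h)
    have hcard : #A + #Q = Fintype.card ι := by
      rw [← card_univ, hA, hQ]
      exact card_filter_add_card_filter_not _
    clear_value A Q
    have hApos : 0 < #A := card_pos.2 ⟨a, haA⟩
    have hQpos : 0 < #Q := card_pos.2 ⟨b, hbQ⟩
    have hBcard : #(univ.filter fun v => f v ∈ Q) = #Q * s + 1 := by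
      rw [card_eq_sum_card_fiberwise (f := f) (t := Q) (by simp [Set.MapsTo])]
      have : ∀ e ∈ Q, #((univ.filter fun v => f v ∈ Q).filter fun v => f v = e) =
          s + (if e = b then 1 else 0) := by
        intro e he
        have hea : e ≠ a := by
          rintro rfl
          exact memQ.1 he haA
        have h1 := hsize e
        rw [if_neg hea, add_zero] at h1
        rw [← h1]
        congr 1
        ext v
        simp only [cls, mem_filter, mem_univ, true_and]
        grind
      rw [sum_congr rfl this, sum_add_distrib]
      simp [hbQ]
    -- every vertex outside the accessible classes has a neighbour in each of them
    have hnb : ∀ y, f y ∈ Q → ∀ e ∈ A, ∃ w, G.Adj y w ∧ f w = e := by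
      intro y hy e he
      by_contra! hcon
      exact memQ.1 hy (memA.2 (.head ⟨y, rfl, hcon⟩ (by simp) (memA.1 he)))
    have hdegB : ∀ y, f y ∈ Q → #A + #(nbIn G f y Q) ≤ #(nbs G y) := fun y hy =>
      card_add_card_nbIn_le hAQ (hnb y hy)
    have hne : ∃ c, c ≠ a ∧ SimpleReach (Movable G f) a ∅ c := by
      by_contra! hcon
      have hA1 : A = {a} := by
        ext e
        rw [memA, mem_singleton]
        exact ⟨fun h => by_contra fun h' => hcon e h' h, fun h => h ▸ ha⟩
      have hA1' : #A = 1 := by rw [hA1, card_singleton]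
      have hle : ∀ z, #(nbIn G f z Q) ≤ #Q := fun z => by
        have h1 := hdeg z
        have h2 := card_add_card_nbIn_le (G := G) (f := f) (v := z) (P := ∅) (Q := Q)
          (by simp) (by simp)
        simp only [card_empty] at h2
        omega
      have h := two_mul_card_le (W := a) (q := #Q) (fun y hy => hnb y hy a haA)
        (fun z _ _ => hle z) (fun z _ => (hle z).trans (by omega))
      have h1 := hsize a
      rw [if_pos rfl, if_neg hab] at h1
      rw [hBcard] at h
      nlinarith
    obtain ⟨U, T, hTne, hUT, hU, hterm, hout⟩ := exists_terminal_set (Movable G f) a hne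
    have hTA : T ⊆ A := fun W hW => memA.2 (hterm W hW).2.1
    have hTsize : ∀ W ∈ T, #(cls f W) = s := by
      intro W hW
      have h := hsize W
      rw [if_neg (hterm W hW).1, if_neg] at h
      · exact h
      · rintro rfl
        exact hb (hterm _ hW).2.1
    -- colouring the inaccessible part without one vertex
    have hsmall : ∀ y, f y ∈ Q → ∃ φ : V → ι,
        (∀ v, f v ∉ A → v ≠ y → φ v ∉ A) ∧
        (∀ u v, f u ∉ A → u ≠ y → f v ∉ A → v ≠ y → G.Adj u v → φ u ≠ φ v) ∧
        ∀ e, e ∉ A → #(univ.filter fun v => (f v ∉ A ∧ v ≠ y) ∧ φ v = e) = s := by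
      intro y hy
      have memS : ∀ v, v ∈ (univ.filter fun v => f v ∈ Q).erase y ↔ f v ∉ A ∧ v ≠ y := by
        intro v
        simp only [mem_erase, mem_filter, mem_univ, true_and, memQ]
        tauto
      obtain ⟨φ, h1, h2, h3⟩ := hfew Q ((univ.filter fun v => f v ∈ Q).erase y) (by omega)
        (by rw [card_erase_of_mem (by simpa using hy), hBcard]; rfl)
        (by
          intro v hv
          have hv' := memQ.2 ((memS v).1 hv).1
          have h1 := hdegB v hv'
          have h2 := hdeg v
          have h3 : #(((univ.filter fun v => f v ∈ Q).erase y).filter fun w => G.Adj v w) ≤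
              #(nbIn G f v Q) := by
            refine card_le_card fun w hw => ?_
            simp only [nbIn, mem_filter, mem_erase, mem_univ, true_and] at hw ⊢
            tauto
          omega)
      simp only [memS] at h1 h2
      refine ⟨φ, fun v hv hvy => memQ.1 (h1 v ⟨hv, hvy⟩),
        fun u v hu huy hv hvy => h2 u ⟨hu, huy⟩ v ⟨hv, hvy⟩, fun e he => ?_⟩
      rw [← h3 e (memQ.2 he)]
      congr 1
      ext v
      rw [mem_filter, mem_filter, memS]
      simp
    by_cases hmov : ∃ y z X, f y ∈ Q ∧ f z ∈ T ∧ Solo G f y z ∧ X ∈ A ∧ X ≠ f z ∧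
        ∀ w, G.Adj z w → f w ≠ X
    · obtain ⟨y, z, X, hy, hz, hyz, hXA, hXz, hzX⟩ := hmov
      have hzA := hTA hz
      obtain ⟨hza, hzr, hzt⟩ := hterm _ hz
      obtain ⟨g, hg, hgf, hgX, hgs⟩ :=
        ((hzt X hXz (memA.1 hXA)).avoid_unreachable (Set.empty_subset _)).exists_shift hf
      have hgz : ∀ v, g v = f z ↔ f v = f z := hgf (f z) (by simp)
      have hgQ : ∀ v, g v ∈ A ↔ f v ∈ A := by
        intro v
        have h1 := hgf (g v)
        have h2 := hgf (f v)
        simp only [Set.mem_union, Set.mem_singleton_iff, Set.mem_ofPred_eq, ← memA] at h1 h2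
        constructor
        · intro h
          by_contra h'
          exact h' ((h2 (.inr h') v).2 rfl ▸ h)
        · intro h
          by_contra h'
          exact h' ((h1 (.inr h') v).1 rfl ▸ h)
      obtain ⟨φ, h1, h2, h3⟩ := hsmall y hy
      simp only [← hgQ] at h1 h2 h3
      have hgzz : g z = f z := (hgz z).2 rfl
      obtain ⟨F, hF, -, -, -, -, hFA, hFQ⟩ := exists_recolor (X := X) (s := s) hg
        (by rw [hgQ]; exact memQ.1 hy) (by rw [hgQ]; exact hzA) (by rwa [hgzz])
        ⟨hyz.1, fun w hw hwz => hyz.2 w hw ((hgz w).1 (hwz.trans hgzz))⟩ h1 h2 h3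
        (fun v _ hv h => hzX v hv (hgX v h))
        (fun v hv hvy _ h => h1 v hv hvy (h ▸ hXA))
      refine ⟨F, hF, fun e => ?_⟩
      by_cases he : e ∈ A
      · have h4 := hFA e he
        have h5 := hgs e
        have h6 := hsize e
        have : e ≠ b := by
          rintro rfl
          exact memQ.1 hbQ he
        rw [if_neg this] at h6
        omega
      · have : e ≠ X := by
          rintro rfl
          exact he hXA
        simpa [this] using hFQ e he
    · push Not at hmov
      -- `z` solo has few neighbours outside
      have hsolo : ∀ y z, f y ∈ Q → f z ∈ T → Solo G f y z → #(nbIn G f z Q) ≤ #Q := by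
        intro y z hy hz hyz
        have h1 := card_add_card_nbIn_le (G := G) (f := f) (v := z) (P := A.erase (f z)) (Q := Q)
          (hAQ.mono_left (erase_subset _ _)) (fun e he =>
            hmov y z e hy hz hyz (mem_of_mem_erase he) (ne_of_mem_erase he))
        rw [card_erase_of_mem (hTA hz)] at h1
        have h2 := hdeg z
        omega
      have htq : #Q < #T := by
        by_contra! hle
        obtain ⟨W, hW⟩ := hTne
        have hall : ∀ z, f z = W → #(nbIn G f z Q) ≤ 2 * #Q := by
          intro z hz
          have hsub : insert U T ⊆ A := insert_subset (memA.2 hU) hTA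
          have h1 := card_add_card_nbIn_le (G := G) (f := f) (v := z) (P := A \ insert U T)
            (Q := Q) (hAQ.mono_left sdiff_subset) (by
              intro e he
              rw [mem_sdiff, mem_insert, not_or] at he
              by_contra! hcon
              rcases hout W hW e ⟨z, hz, hcon⟩ (memA.1 he.1) with h | h
              · exact he.2.2 h
              · exact he.2.1 h)
          have h2 := card_sdiff_add_card_eq_card hsub
          rw [card_insert_of_notMem hUT] at h2
          have h3 := hdeg z
          omega
        have h := two_mul_card_le (W := W) (q := #Q)
          (fun y hy => hnb y hy W (hTA hW))
          (fun z hz ⟨y, hy, hyz⟩ => hsolo y z hy (hz ▸ hW) hyz) hall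
        rw [hBcard, hTsize W hW] at h
        nlinarith
      obtain ⟨I, hIQ, hIind, hIsum⟩ := exists_indep_sum_ge G f Q
      have hpig : ∃ z, f z ∈ T ∧ 1 < #(I.filter fun y => Solo G f y z) := by
        by_contra! hcon
        have h1 : ∑ y ∈ I, #(univ.filter fun z => f z ∈ T ∧ Solo G f y z) =
            ∑ z ∈ univ.filter (fun z => f z ∈ T), #(I.filter fun y => Solo G f y z) := by
          have := sum_card_bipartiteAbove_eq_sum_card_bipartiteBelow
            (s := I) (t := univ.filter fun z => f z ∈ T) (Solo G f)
          simpa only [bipartiteAbove, bipartiteBelow, filter_filter] using this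
        have h2 : ∑ z ∈ univ.filter (fun z => f z ∈ T), #(I.filter fun y => Solo G f y z) ≤
            #T * s := by
          refine (sum_le_sum (g := fun _ => 1) fun z hz => hcon z (by simpa using hz)).trans ?_
          rw [← card_eq_sum_ones,
            card_eq_sum_card_fiberwise (f := f) (t := T) (by simp [Set.MapsTo])]
          refine le_of_eq ?_
          rw [← smul_eq_mul, ← sum_const]
          refine sum_congr rfl fun e he => ?_
          rw [← hTsize e he]
          congr 1
          ext v
          simp only [cls, mem_filter, mem_univ, true_and]
          grind
        have h3 : ∑ y ∈ I, (#(nbIn G f y Q) + 1 + #T) ≤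
            ∑ y ∈ I, (#(univ.filter fun z => f z ∈ T ∧ Solo G f y z) + #Q) := by
          refine sum_le_sum fun y hy => ?_
          have h4 := card_add_card_add_card_nbIn_le hAQ hTA (hnb y (hIQ y hy))
          have h5 := hdeg y
          omega
        have h4 : ∑ y ∈ I, (#(nbIn G f y Q) + 1) ≤ #I * #Q := by
          rw [← smul_eq_mul, ← sum_const]
          refine sum_le_sum fun y hy => ?_
          have h5 := hdegB y (hIQ y hy)
          have h6 := hdeg y
          omega
        rw [hBcard] at hIsum
        simp only [sum_add_distrib, sum_const, smul_eq_mul, mul_one] at h3 h4 hIsum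
        have h5 : s < #I := by
          by_contra! hle
          nlinarith
        obtain ⟨d, hd⟩ := Nat.exists_eq_add_of_lt htq
        rw [hd] at h3 h2
        nlinarith
      obtain ⟨z, hz, hlt⟩ := hpig
      obtain ⟨y₁, hy₁, y₂, hy₂, hne₁₂⟩ := one_lt_card.1 hlt
      rw [mem_filter] at hy₁ hy₂
      have hy₁Q := hIQ y₁ hy₁.1
      have hy₂Q := hIQ y₂ hy₂.1
      have hzA := hTA hz
      obtain ⟨hza, hzr, hzt⟩ := hterm _ hz
      obtain ⟨φ, h1, h2, h3⟩ := hsmall y₁ hy₁Q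
      obtain ⟨X, hXQ, hX⟩ : ∃ X ∈ Q, ∀ v, f v ∉ A → v ≠ y₁ → G.Adj z v → φ v ≠ X := by
        by_contra! hcon
        have hle := hsolo y₁ z hy₁Q hz hy₁.2
        have hmem : y₁ ∈ nbIn G f z Q := by
          simp only [nbIn, mem_filter, mem_univ, true_and]
          exact ⟨hy₁.2.1.symm, hy₁Q⟩
        have hsub : Q ⊆ ((nbIn G f z Q).erase y₁).image φ := by
          intro e he
          obtain ⟨v, hv, hvy, hzv, hve⟩ := hcon e he
          refine mem_image.2 ⟨v, mem_erase.2 ⟨hvy, ?_⟩, hve⟩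
          simp only [nbIn, mem_filter, mem_univ, true_and]
          exact ⟨hzv, memQ.2 hv⟩
        have h4 := (card_le_card hsub).trans card_image_le
        rw [card_erase_of_mem hmem] at h4
        omega
      have hXA := memQ.1 hXQ
      obtain ⟨F, hF, hFf, hFy, hFz, hFB, hFA, hFQ⟩ := exists_recolor (X := X) (s := s) hf
        (memQ.1 hy₁Q) hzA (fun h => hXA (h ▸ hzA)) hy₁.2 h1 h2 h3
        (fun v hv _ h => hXA (h ▸ hv)) hX
      have hFinv : ∀ v, F v ∈ A → F v ≠ f z → f v = F v := by
        intro v hv hvz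
        by_cases hvA : f v ∈ A
        · refine (hFf v hvA ?_).symm
          rintro rfl
          exact hXA (hFz ▸ hv)
        · by_cases hvy : v = y₁
          · rw [hvy] at hvz
            exact absurd hFy hvz
          · exact absurd hv (hFB v hvA hvy)
      have hreach : ∀ c ∈ A, c ≠ f z → SimpleReach (Movable G F) a ∅ c := by
        intro c hc hcz
        refine ((hzt c hcz (memA.1 hc)).mono subset_rfl ?_).anti (Set.empty_subset _)
        rintro _ d hx hd ⟨u, rfl, hu⟩
        have hxA := memA.2 (hx.anti (Set.empty_subset _))
        have hdA := memA.2 (hd.anti (Set.empty_subset _))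
        have hxz : f u ≠ f z := hx.notMem
        have hdz : d ≠ f z := hd.notMem
        refine ⟨u, hFf u hxA fun h => hxz (h ▸ rfl), fun w hw h => hu w hw ?_⟩
        rw [← h]
        exact hFinv w (h ▸ hdA) (h ▸ hdz)
      have hreachz : SimpleReach (Movable G F) a ∅ (f z) := by
        generalize hW : f z = W at *
        cases hzr with
        | refl => exact absurd rfl hza
        | @step _ _ d hWd _ hd =>
          have hdA := memA.2 (hd.anti (Set.empty_subset _))
          have hdW : d ≠ W := by simpa using hd.notMem
          obtain ⟨u, hu, hud⟩ := hWd
          have huz : u ≠ z := by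
            rintro rfl
            obtain ⟨w, hw, hwd⟩ := hmov y₁ u d hy₁Q (hW ▸ hz) hy₁.2 hdA (hW ▸ hdW)
            exact hud w hw hwd
          refine .head ⟨u, ?_, fun w hw h => hud w hw ?_⟩ (by simp) (hreach d hdA hdW)
          · rw [← hu]
            exact hFf u (hu ▸ hzA) huz
          · rw [← h]
            exact hFinv w (h ▸ hdA) (h ▸ hdW)
      have hreachA : ∀ c ∈ A, SimpleReach (Movable G F) a ∅ c := by
        intro c hc
        by_cases hcz : c = f z
        · exact hcz ▸ hreachz
        · exact hreach c hc hcz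
      have hFy₂ : F y₂ ∉ A := hFB y₂ (memQ.1 hy₂Q) hne₁₂.symm
      have hreachy : SimpleReach (Movable G F) a ∅ (F y₂) := by
        refine .head ⟨y₂, rfl, fun w hw h => ?_⟩ (by simp) hreachz
        by_cases hwA : f w ∈ A
        · by_cases hwz : w = z
          · rw [hwz, hFz] at h
            exact hXA (h ▸ hzA)
          · rw [hFf w hwA hwz] at h
            exact hwz (hy₂.2.2 w hw h)
        · by_cases hwy : w = y₁
          · exact hIind y₂ hy₂.1 y₁ hy₁.1 (hwy ▸ hw)
          · exact hFB w hwA hwy (h ▸ hzA)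
      refine ih F a X hF (fun e => ?_) ?_
      · by_cases he : e ∈ A
        · have h4 := hFA e he
          have h6 := hsize e
          have : e ≠ b := by
            rintro rfl
            exact memQ.1 hbQ he
          rw [if_neg this] at h6
          omega
        · have : e ≠ a := by
            rintro rfl
            exact he haA
          simpa [this] using hFQ e he
      · have hss : (univ.filter fun e => ¬ SimpleReach (Movable G F) a ∅ e) ⊂ Q := by
          refine (ssubset_iff_of_subset fun e he => ?_).2 ⟨F y₂, memQ.2 hFy₂, by simpa using hreachy⟩
          rw [mem_filter] at he
          exact memQ.2 fun h => he.2 (hreachA e h)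
        have := card_lt_card hss
        omega

end Coloring

open scoped Classical in
/-- The **Hajnal–Szemerédi theorem** (for a number of vertices divisible by the number of
colours). -/
theorem exists_equitable_coloring (k : ℕ) {V ι : Type} [Fintype V] [Fintype ι]
    (hk : Fintype.card ι = k) (G : SimpleGraph V) (s : ℕ) (hV : Fintype.card V = k * s)
    (hdeg : ∀ v, #(nbs G v) < k) :
    ∃ f : V → ι, IsProper G f ∧ ∀ c, #(cls f c) = s := by
  induction k using Nat.strong_induction_on generalizing V ι with
  | _ k ih =>
  subst hk
  -- only the edges inside `T` are taken into account
  let GT : Finset V → SimpleGraph V := fun T =>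
    { Adj := fun u v => G.Adj u v ∧ u ∈ T ∧ v ∈ T
      symm := ⟨fun u v h => ⟨h.1.symm, h.2.2, h.2.1⟩⟩
      loopless := ⟨fun u h => h.1.ne rfl⟩ }
  suffices h : ∀ T : Finset V, ∃ f : V → ι, IsProper (GT T) f ∧ ∀ c, #(cls f c) = s by
    obtain ⟨f, hf, hs⟩ := h univ
    exact ⟨f, fun u v huv => hf u v ⟨huv, mem_univ _, mem_univ _⟩, hs⟩
  intro T
  induction T using Finset.induction_on with
  | empty =>
    have e : V ≃ ι × Fin s := Fintype.equivOfCardEq (by simp [hV])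
    refine ⟨fun v => (e v).1, fun u v huv => absurd huv.2.1 (notMem_empty _), fun c => ?_⟩
    have : cls (fun v => (e v).1) c = univ.image fun i : Fin s => e.symm (c, i) := by
      ext v
      simp only [cls, mem_filter, mem_univ, true_and, mem_image]
      constructor
      · rintro rfl
        exact ⟨(e v).2, by simp⟩
      · rintro ⟨i, rfl⟩
        simp
    rw [this, card_image_of_injective _ fun i j hij => by simpa using hij, card_univ,
      Fintype.card_fin]
  | insert u T hu ihT =>
    obtain ⟨f, hf, hs⟩ := ihT
    have hdegT : ∀ v, #(nbs (GT (insert u T)) v) < Fintype.card ι := fun v =>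
      (card_le_card fun w hw => by
        simp only [nbs, mem_filter, mem_univ, true_and] at hw ⊢
        exact hw.1).trans_lt (hdeg v)
    obtain ⟨c, hc⟩ : ∃ c, ∀ w, (GT (insert u T)).Adj u w → f w ≠ c := by
      by_contra! hcon
      have hsub : (univ : Finset ι) ⊆ (nbs (GT (insert u T)) u).image f := by
        intro c _
        obtain ⟨w, hw, hwc⟩ := hcon c
        exact mem_image.2 ⟨w, by simpa [nbs] using hw, hwc⟩
      have h1 := (card_le_card hsub).trans card_image_le
      have h2 := hdegT u
      rw [card_univ] at h1
      omega
    refine exists_equitable_of_nearly_equitable (s := s) hdegT ?_ _ (Function.update f u c)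
      (f u) c ?_ (fun e => ?_) le_rfl
    · intro C S hC hS hdS
      obtain ⟨g, hg, hgs⟩ := ih #C hC (V := S) (ι := C) (by simp)
        ((GT (insert u T)).comap Subtype.val) (by simpa using hS) (by
          intro v
          refine lt_of_eq_of_lt ?_ (hdS v v.2)
          rw [← card_map (Function.Embedding.subtype _)]
          congr 1
          ext w
          simp [nbs, and_comm])
      refine ⟨fun v => if h : v ∈ S then (g ⟨v, h⟩ : ι) else c, fun v hv => ?_,
        fun x hx y hy hxy => ?_, fun d hd => ?_⟩
      · simp [hv]
      · simp only [hx, hy, dite_true]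
        exact fun h => hg ⟨x, hx⟩ ⟨y, hy⟩ hxy (Subtype.ext h)
      · rw [← hgs ⟨d, hd⟩, ← card_map (Function.Embedding.subtype _)]
        congr 1
        ext w
        simp only [cls, mem_filter, mem_map, mem_univ, true_and, Function.Embedding.subtype_apply,
          Subtype.exists, exists_and_right, exists_eq_right]
        constructor
        · rintro ⟨hw, h⟩
          exact ⟨hw, Subtype.ext (by simpa [hw] using h)⟩
        · rintro ⟨hw, h⟩
          exact ⟨hw, by simp [hw, h]⟩
    · intro x y hxy
      have hne := hxy.ne
      by_cases hx : x = u
      · subst hx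
        simpa [Function.update_of_ne hne.symm] using (hc y hxy).symm
      · by_cases hy : y = u
        · subst hy
          simpa [Function.update_of_ne hx] using hc x hxy.symm
        · rw [Function.update_of_ne hx, Function.update_of_ne hy]
          exact hf x y ⟨hxy.1, mem_of_mem_insert_of_ne hxy.2.1 hx,
            mem_of_mem_insert_of_ne hxy.2.2 hy⟩
    · have := card_cls_update f u c e
      rwa [hs e] at this

end HajnalSzemeredi

theorem perfect_tiling_from_hajnal_szemeredi (n h : ℕ) (hdvd : h ∣ n)
    (H : SimpleGraph (Fin h)) (G : SimpleGraph (Fin n))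
    (hdeg : ∀ v : Fin n, (1 - 1 / (h : ℝ)) * n ≤ (odeg G v : ℝ)) :
    HasPerfectTiling H G := by
  classical
  obtain ⟨k, rfl⟩ := hdvd
  rcases Nat.eq_zero_or_pos h with rfl | hpos
  · refine ⟨∅, by simp, by simp, ?_⟩
    ext v
    exact absurd v.isLt (by simp)
  have hcompl : ∀ v, #(HajnalSzemeredi.nbs Gᶜ v) < k := by
    intro v
    have hv := hdeg v
    have hodeg : odeg G v = #(HajnalSzemeredi.nbs G v) := by
      rw [odeg, ← Set.ncard_coe_finset]
      congr 1
      ext w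
      simp [HajnalSzemeredi.nbs]
    have hsum : #(HajnalSzemeredi.nbs Gᶜ v) + #(HajnalSzemeredi.nbs G v) < h * k := by
      rw [← card_union_of_disjoint]
      · refine (card_lt_card (ssubset_univ_iff.2 fun hun => ?_)).trans_eq (by simp)
        have := hun ▸ mem_univ v
        simp [HajnalSzemeredi.nbs] at this
      · rw [disjoint_left]
        intro w hw hw'
        simp only [HajnalSzemeredi.nbs, mem_filter, mem_univ, true_and,
          SimpleGraph.compl_adj] at hw hw'
        exact hw.2 hw'
    have hreal : (h : ℝ) * k - k ≤ odeg G v := by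
      refine le_of_eq_of_le ?_ hv
      have : (h : ℝ) ≠ 0 := by positivity
      push_cast
      field_simp
    have hnat : h * k ≤ odeg G v + k := by
      rify
      linarith
    omega
  obtain ⟨f, hf, hs⟩ := HajnalSzemeredi.exists_equitable_coloring k (ι := Fin k) (by simp) Gᶜ h
    (by simp [mul_comm]) hcompl
  refine ⟨univ.image (HajnalSzemeredi.cls f), ?_, ?_, ?_⟩
  · intro S hS
    obtain ⟨c, -, rfl⟩ := mem_image.1 hS
    let φ := (HajnalSzemeredi.cls f c).orderEmbOfFin (hs c)
    refine ⟨φ, ⟨φ.strictMono, fun i j hij => ?_⟩, ?_⟩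
    · by_contra hcon
      have hmem : ∀ i, f (φ i) = c := fun i =>
        HajnalSzemeredi.mem_cls.1 ((HajnalSzemeredi.cls f c).orderEmbOfFin_mem (hs c) i)
      refine hf (φ i) (φ j) ?_ ((hmem i).trans (hmem j).symm)
      rw [SimpleGraph.compl_adj]
      exact ⟨fun h => hij.ne (φ.injective h), hcon⟩
    · exact image_orderEmbOfFin_univ _ (hs c)
  · intro S hS S' hS' hne
    simp only [coe_image, Set.mem_image] at hS hS'
    obtain ⟨c, -, rfl⟩ := hS
    obtain ⟨d, -, rfl⟩ := hS'
    refine disjoint_left.2 fun v hv hv' => hne ?_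
    simp only [id, HajnalSzemeredi.cls, mem_filter, mem_univ, true_and] at hv hv'
    rw [← hv, ← hv']
  · ext v
    simp [HajnalSzemeredi.cls]
end

section
/- Let H be an ordered graph on h vertices such that 12 is an edge of H or (h−1)h is an edge of H. Then for every positive integer n divisible by h, there exists an ordered graph G on vertex set [n] with minimum degree δ(G) ≥ (1 − 1/h)n − 1 that does not contain a perfect H-tiling. -/
open Finset

section EndEdges

variable {h n : ℕ}

/-- The graph on `[n]` in which two distinct vertices are adjacent unless both lie in `A`. -/
def completeOutside (A : Finset (Fin n)) : SimpleGraph (Fin n) where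
  Adj u v := u ≠ v ∧ ¬ (u ∈ A ∧ v ∈ A)
  symm := ⟨fun _ _ huv => ⟨huv.1.symm, fun hA => huv.2 hA.symm⟩⟩
  loopless := ⟨fun _ hu => hu.1 rfl⟩

theorem le_odeg_completeOutside_add_card {A : Finset (Fin n)} (hA : A.Nonempty) (v : Fin n) :
    n ≤ odeg (completeOutside A) v + A.card := by
  have of_subset {B : Finset (Fin n)} (hB : B.card ≤ A.card)
      (hsub : ((Bᶜ : Finset (Fin n)) : Set (Fin n)) ⊆ (completeOutside A).neighborSet v) :
      n ≤ odeg (completeOutside A) v + A.card := by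
    have hle := Set.ncard_le_ncard hsub
    rw [Set.ncard_coe_finset, card_compl, Fintype.card_fin] at hle
    unfold odeg
    omega
  by_cases hv : v ∈ A
  · refine of_subset le_rfl fun u hu => ?_
    have huA : u ∉ A := by simpa using hu
    exact ⟨fun huv => huA (huv ▸ hv), fun huv => huA huv.2⟩
  · refine of_subset (B := {v}) (by simpa using hA.card_pos) fun u hu => ?_
    have huv : u ≠ v := by simpa using hu
    exact ⟨huv.symm, fun hvu => hv hvu.1⟩

theorem IsCopySet.card_eq {H : SimpleGraph (Fin h)} {G : SimpleGraph (Fin n)}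
    {S : Finset (Fin n)} (hS : IsCopySet H G S) : S.card = h := by
  obtain ⟨φ, hφ, rfl⟩ := hS
  rw [card_image_of_injective _ hφ.1.injective, card_univ, Fintype.card_fin]

/-- If every copy of `H` meets `A` in at most one vertex, then a perfect `H`-tiling has at least
`A.card` members. -/
theorem HasPerfectTiling.card_mul_le {H : SimpleGraph (Fin h)} {G : SimpleGraph (Fin n)}
    {A : Finset (Fin n)} (hG : HasPerfectTiling H G)
    (hA : ∀ T, IsCopySet H G T → (A ∩ T).card ≤ 1) : A.card * h ≤ n := by
  obtain ⟨𝒯, hcopy, hdisj, hcover⟩ := hG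
  have hn : n = 𝒯.card * h := by
    have hcard := card_biUnion hdisj
    rw [hcover, card_univ, Fintype.card_fin] at hcard
    exact hcard.trans (sum_const_nat fun T hT => (hcopy T hT).card_eq)
  have hAcard : A.card ≤ 𝒯.card := by
    calc A.card = (𝒯.biUnion fun T => A ∩ T).card := by
          rw [← inter_biUnion]
          exact congrArg card ((congrArg (A ∩ ·) hcover).trans (inter_univ A)).symm
      _ ≤ ∑ T ∈ 𝒯, (A ∩ T).card := card_biUnion_le
      _ ≤ 𝒯.card * 1 := sum_le_card_nsmul _ _ _ fun T hT => hA T (hcopy T hT)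
      _ = 𝒯.card := mul_one _
  exact (Nat.mul_le_mul_right h hAcard).trans_eq hn.symm

/-- If any strictly increasing map sending two vertices into `A` also sends an edge of `H` into `A`,
then each copy of `H` in `completeOutside A` meets `A` in at most one vertex. -/
theorem card_inter_le_one_of_isCopySet {H : SimpleGraph (Fin h)} {A T : Finset (Fin n)}
    (hT : IsCopySet H (completeOutside A) T)
    (hA : ∀ φ : Fin h → Fin n, StrictMono φ → ∀ x y : Fin h, x < y → φ x ∈ A → φ y ∈ A →
      ∃ a b : Fin h, H.Adj a b ∧ φ a ∈ A ∧ φ b ∈ A) : (A ∩ T).card ≤ 1 := by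
  obtain ⟨φ, ⟨hmono, hadj⟩, rfl⟩ := hT
  have hnot : ∀ x y : Fin h, φ x ∈ A → φ y ∈ A → ¬ x < y := fun x y hx hy hxy => by
    obtain ⟨a, b, hab, haA, hbA⟩ := hA φ hmono x y hxy hx hy
    exact (hadj a b hab).2 ⟨haA, hbA⟩
  refine card_le_one.2 fun u hu v hv => ?_
  obtain ⟨huA, hu⟩ := mem_inter.1 hu
  obtain ⟨hvA, hv⟩ := mem_inter.1 hv
  obtain ⟨x, -, rfl⟩ := mem_image.1 hu
  obtain ⟨y, -, rfl⟩ := mem_image.1 hv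
  rw [le_antisymm (not_lt.1 (hnot y x hvA huA)) (not_lt.1 (hnot x y huA hvA))]

end EndEdges

theorem extremal_example_end_edges (h : ℕ) (H : SimpleGraph (Fin h))
    (hedge : (∃ a b : Fin h, H.Adj a b ∧ (a : ℕ) + 1 = 1 ∧ (b : ℕ) + 1 = 2) ∨
             (∃ a b : Fin h, H.Adj a b ∧ (a : ℕ) + 1 = h - 1 ∧ (b : ℕ) + 1 = h))
    (n : ℕ) (hn : 0 < n) (hdvd : h ∣ n) :
    ∃ G : SimpleGraph (Fin n),
      (∀ v : Fin n, (1 - 1 / (h : ℝ)) * n - 1 ≤ (odeg G v : ℝ)) ∧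
      ¬ HasPerfectTiling H G := by
  obtain ⟨m, rfl⟩ := hdvd
  have hh : 2 ≤ h := by
    rcases hedge with ⟨a, b, hab, ha, hb⟩ | ⟨a, b, hab, ha, hb⟩ <;> omega
  have hm : 0 < m := Nat.pos_of_mul_pos_left hn
  have hmn : m + 1 ≤ h * m := by nlinarith
  obtain ⟨A, hcard, hA⟩ : ∃ A : Finset (Fin (h * m)), A.card = m + 1 ∧
      ∀ φ : Fin h → Fin (h * m), StrictMono φ → ∀ x y : Fin h, x < y → φ x ∈ A → φ y ∈ A →
        ∃ a b : Fin h, H.Adj a b ∧ φ a ∈ A ∧ φ b ∈ A := by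
    rcases hedge with ⟨a, b, hab, ha, hb⟩ | ⟨a, b, hab, ha, hb⟩
    · refine ⟨Iic ⟨m, by omega⟩, by simp, fun φ hφ x y hxy _ hy => ⟨a, b, hab, ?_, ?_⟩⟩
      · exact mem_Iic.2 ((hφ.monotone (by omega)).trans (mem_Iic.1 hy))
      · exact mem_Iic.2 ((hφ.monotone (by omega)).trans (mem_Iic.1 hy))
    · refine ⟨Ici ⟨h * m - (m + 1), by omega⟩, by rw [Fin.card_Ici]; simp only; omega,
        fun φ hφ x y hxy hx _ => ⟨a, b, hab, ?_, ?_⟩⟩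
      · exact mem_Ici.2 ((mem_Ici.1 hx).trans (hφ.monotone (by omega)))
      · exact mem_Ici.2 ((mem_Ici.1 hx).trans (hφ.monotone (by omega)))
  refine ⟨completeOutside A, fun v => ?_, fun hG => ?_⟩
  · have hdeg := le_odeg_completeOutside_add_card (card_pos.1 (by omega : 0 < A.card)) v
    have hdeg' : ((h * m : ℕ) : ℝ) ≤ odeg (completeOutside A) v + (m + 1) := by
      rw [hcard] at hdeg
      exact_mod_cast hdeg
    have hh0 : (h : ℝ) ≠ 0 := by positivity
    have hmul : (1 - 1 / (h : ℝ)) * ((h * m : ℕ) : ℝ) = ((h * m : ℕ) : ℝ) - m := by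
      push_cast
      field_simp
    linarith
  · have hle := hG.card_mul_le fun T hT => card_inter_le_one_of_isCopySet hT hA
    rw [hcard] at hle
    nlinarith
end
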